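/- Assume γ = 2 or γ ≥ 9/4, and let (u,θ) be a classical solution of the thermal reduced Burgers system on 𝕋³ × [0,T] with θ₀ ≥ 1 on 𝕋³. Then there exists a constant C = C(ν, γ) > 0 such that sup_{t ∈ [0,T]} ( ½‖u(·,t)‖²_{L²(𝕋³)} + ‖θ(·,t)‖²_{L²(𝕋³)} ) ≤ ½‖u₀‖²_{L²(𝕋³)} + ‖θ₀‖²_{L²(𝕋³)} + C(T² + 1)(‖u₀‖^{3γ−3}_{L^γ(𝕋³)} + 1). -/

import Mathlib

open MeasureTheory Real
open scoped ENNReal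

noncomputable section

/-- Points of `ℝ³`; `ℤ³`-periodic functions on `Sp` model functions on the torus `𝕋³`. -/
abbrev Sp : Type := Fin 3 → ℝ

/-- A fundamental cell for the torus `𝕋³ = ℝ³/ℤ³`; integrals over `𝕋³` are integrals
over `cell`. -/
def cell : Set Sp := Set.Icc 0 1

/-- The `i`-th partial derivative `∂ᵢ f`. -/
def pd (i : Fin 3) (f : Sp → ℝ) (x : Sp) : ℝ := fderiv ℝ f x (Pi.single i 1)

/-- `ℤ³`-periodicity: such a function descends to the torus `𝕋³`. -/
def Periodic3 (f : Sp → ℝ) : Prop :=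
  ∀ (x : Sp) (k : Fin 3 → ℤ), f (x + fun i => (k i : ℝ)) = f x

/-- `|∇u|²` for a vector field `u`. -/
def gradSqV (u : Sp → Fin 3 → ℝ) (x : Sp) : ℝ :=
  ∑ i, ∑ j, (pd i (fun y => u y j) x) ^ 2

/-- `|∇²u|²` for a vector field `u`. -/
def hessSqV (u : Sp → Fin 3 → ℝ) (x : Sp) : ℝ :=
  ∑ i, ∑ j, ∑ k, (pd i (pd j (fun y => u y k)) x) ^ 2

/-- `|∇f|²` for a scalar field `f`. -/
def gradSqS (f : Sp → ℝ) (x : Sp) : ℝ := ∑ i, (pd i f x) ^ 2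

/-- A classical solution `(u, θ)` of the thermal reduced Burgers system
`∂ₜuⱼ + uᵢ∂ᵢuⱼ + (1/γ)uⱼ∂ᵢuᵢ − ν∂ᵢ(θ∂ᵢuⱼ) = 0`,
`∂ₜ(θ²) + ∂ᵢ(uᵢθ²) − κ∂ᵢ(θ∂ᵢ(θ²)) = νθ|∇u|²` on `𝕋³ × [0,T]`, with `θ₀ ≥ 1`. -/
structure ThermalBurgers (ν κ γ T : ℝ) (u : ℝ → Sp → Fin 3 → ℝ)
    (θ : ℝ → Sp → ℝ) : Prop where
  T_pos : 0 < T
  smooth_u : ContDiff ℝ (⊤ : ℕ∞) fun q : ℝ × Sp => u q.1 q.2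
  smooth_θ : ContDiff ℝ (⊤ : ℕ∞) fun q : ℝ × Sp => θ q.1 q.2
  periodic_u : ∀ t j, Periodic3 fun x => u t x j
  periodic_θ : ∀ t, Periodic3 (θ t)
  momentum : ∀ t ∈ Set.Icc (0 : ℝ) T, ∀ x, ∀ j,
    deriv (fun s => u s x j) t
      + (∑ i, u t x i * pd i (fun y => u t y j) x)
      + (1 / γ) * u t x j * (∑ i, pd i (fun y => u t y i) x)
      - ν * ∑ i, pd i (fun y => θ t y * pd i (fun z => u t z j) y) x = 0
  heat : ∀ t ∈ Set.Icc (0 : ℝ) T, ∀ x,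
    deriv (fun s => θ s x ^ 2) t
      + (∑ i, pd i (fun y => u t y i * θ t y ^ 2) x)
      - κ * (∑ i, pd i (fun y => θ t y * pd i (fun z => θ t z ^ 2) y) x)
      = ν * θ t x * gradSqV (u t) x
  θ0_ge_one : ∀ x, 1 ≤ θ 0 x

lemma Continuous.integrableOn_cell {f : Sp → ℝ} (hf : Continuous f) : IntegrableOn f cell :=
  hf.continuousOn.integrableOn_compact isCompact_Icc

/-- The divergence of a periodic `C¹` vector field has zero mean over the torus. -/
lemma integral_cell_div_eq_zero (V : Fin 3 → Sp → ℝ) (hV : ∀ i, ContDiff ℝ 1 (V i))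
    (hp : ∀ i, Periodic3 (V i)) : ∫ x in cell, ∑ i, pd i (V i) x = 0 := by
  have hd : ∀ i, Continuous fun x => pd i (V i) x := fun i =>
    ((hV i).continuous_fderiv one_ne_zero).clm_apply continuous_const
  have key := integral_divergence_of_hasFDerivAt_off_countable' (n := 2) (a := (0 : Sp)) (b := 1)
    (by intro i; simp) V (fun i x => fderiv ℝ (V i) x) ∅ Set.countable_empty
    (fun i => (hV i).continuous.continuousOn)
    (fun x _ i => ((hV i).differentiable one_ne_zero x).hasFDerivAt)
    (Continuous.integrableOn_cell (continuous_finsetSum _ fun i _ => hd i))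
  unfold cell pd
  rw [key]
  refine Finset.sum_eq_zero fun i _ => sub_eq_zero.2 (integral_congr_ae (ae_of_all _ fun x => ?_))
  have h := hp i (i.insertNth (0 : ℝ) x) (Pi.single i 1)
  have e : (i.insertNth (0 : ℝ) x + fun j => ((Pi.single i 1 : Fin 3 → ℤ) j : ℝ) : Sp)
      = i.insertNth (1 : ℝ) x := by
    funext j
    refine Fin.succAboveCases i ?_ (fun k => ?_) j
    · simp
    · simp [Pi.single_apply, Fin.succAbove_ne]
  rw [e] at h
  simpa using h

/-- Differentiation under the integral over the torus. -/
lemma hasDerivAt_integral_cell (f : ℝ × Sp → ℝ) (hf : ContDiff ℝ 1 f) (t : ℝ) :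
    HasDerivAt (fun s => ∫ x in cell, f (s, x)) (∫ x in cell, deriv (fun s => f (s, x)) t) t := by
  have hder : ∀ s x, HasDerivAt (fun s => f (s, x)) (fderiv ℝ f (s, x) (1, 0)) s := fun s x =>
    ((hf.differentiable one_ne_zero (s, x)).hasFDerivAt).comp_hasDerivAt s
      ((hasDerivAt_id s).prodMk (hasDerivAt_const s x))
  have hc : Continuous fun q : ℝ × Sp => fderiv ℝ f q (1, 0) :=
    (hf.continuous_fderiv one_ne_zero).clm_apply continuous_const
  obtain ⟨M, hM⟩ := ((isCompact_Icc (a := t - 1) (b := t + 1)).prod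
    (isCompact_Icc (a := (0 : Sp)) (b := 1))).exists_bound_of_continuousOn hc.continuousOn
  have h := hasDerivAt_integral_of_dominated_loc_of_deriv_le (μ := volume.restrict cell)
    (F := fun s x => f (s, x)) (F' := fun s x => fderiv ℝ f (s, x) (1, 0)) (x₀ := t)
    (s := Set.Icc (t - 1) (t + 1)) (bound := fun _ => M)
    (Icc_mem_nhds (by linarith) (by linarith))
    (Filter.Eventually.of_forall fun s =>
      (hf.continuous.comp (by fun_prop : Continuous fun x : Sp => (s, x))).aestronglyMeasurable)
    (Continuous.integrableOn_cell (hf.continuous.comp (by fun_prop : Continuous fun x : Sp => (t, x))))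
    (hc.comp (by fun_prop : Continuous fun x : Sp => (t, x))).aestronglyMeasurable
    ((ae_restrict_iff' measurableSet_Icc).2 (ae_of_all _ fun x hx s hs => hM (s, x) ⟨hs, hx⟩))
    (Continuous.integrableOn_cell continuous_const)
    (ae_of_all _ fun x s _ => hder s x)
  have e : ∀ x, deriv (fun s => f (s, x)) t = fderiv ℝ f (t, x) (1, 0) := fun x => (hder t x).deriv
  simp only [e]
  exact h.2

/-- `y ↦ |y|²` on `ℝ³`. -/
def nsq (y : Fin 3 → ℝ) : ℝ := ∑ j, y j ^ 2

lemma nsq_nonneg (y : Fin 3 → ℝ) : 0 ≤ nsq y := Finset.sum_nonneg fun _ _ => sq_nonneg _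

lemma nsq_eq_zero {y : Fin 3 → ℝ} : nsq y = 0 ↔ y = 0 := by
  unfold nsq
  rw [Finset.sum_eq_zero_iff_of_nonneg fun _ _ => sq_nonneg _]
  simp [funext_iff]

lemma sq_le_nsq (y : Fin 3 → ℝ) (j : Fin 3) : y j ^ 2 ≤ nsq y :=
  Finset.single_le_sum (f := fun j => y j ^ 2) (fun _ _ => sq_nonneg _) (Finset.mem_univ j)

lemma contDiff_nsq : ContDiff ℝ (⊤ : ℕ∞) nsq := by unfold nsq; fun_prop

@[fun_prop]
lemma continuous_nsq : Continuous nsq := contDiff_nsq.continuous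

lemma hasFDerivAt_nsq (y : Fin 3 → ℝ) :
    HasFDerivAt nsq (∑ k, (2 * y k) • ContinuousLinearMap.proj (R := ℝ) (φ := fun _ : Fin 3 => ℝ) k) y := by
  unfold nsq
  refine HasFDerivAt.fun_sum fun k _ => ?_
  have := ((ContinuousLinearMap.proj (R := ℝ) (φ := fun _ : Fin 3 => ℝ) k).hasFDerivAt (x := y)).pow 2
  simpa using this

lemma nsq_rpow_eq_norm (a : ℝ) (y : Fin 3 → ℝ) :
    nsq y ^ a = ‖(WithLp.toLp 2 y : EuclideanSpace ℝ (Fin 3))‖ ^ (2 * a) := by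
  rw [EuclideanSpace.norm_eq, Real.sqrt_eq_rpow, ← Real.rpow_mul (Finset.sum_nonneg fun _ _ => by positivity)]
  simp [nsq]

/-- `|y|^{2a}` is `C¹` as soon as `2a > 1`. -/
lemma contDiff_nsq_rpow {a : ℝ} (ha : 1 < 2 * a) : ContDiff ℝ 1 fun y => nsq y ^ a := by
  simp only [nsq_rpow_eq_norm]
  refine ContDiff.norm_rpow ?_ ha
  exact (PiLp.continuousLinearEquiv 2 ℝ (fun _ : Fin 3 => ℝ)).symm.contDiff

lemma hasFDerivAt_nsq_rpow {a : ℝ} (ha : 1 < 2 * a) (y : Fin 3 → ℝ) :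
    HasFDerivAt (fun y => nsq y ^ a) (∑ k, (2 * a * nsq y ^ (a - 1) * y k) •
      ContinuousLinearMap.proj (R := ℝ) (φ := fun _ : Fin 3 => ℝ) k) y := by
  by_cases hy : nsq y = 0
  · have h := ((contDiff_nsq_rpow ha).differentiable one_ne_zero y).hasFDerivAt
    have hmin : IsLocalMin (fun y => nsq y ^ a) y := by
      refine Filter.Eventually.of_forall fun z => ?_
      simp only [hy, Real.zero_rpow (by linarith : a ≠ 0)]
      exact Real.rpow_nonneg (nsq_nonneg z) _
    rw [hmin.fderiv_eq_zero] at h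
    have hy' := nsq_eq_zero.1 hy
    simpa [hy'] using h
  · have h := (hasFDerivAt_nsq y).rpow_const (p := a) (Or.inl hy)
    refine h.congr_fderiv ?_
    rw [Finset.smul_sum]
    refine Finset.sum_congr rfl fun k _ => ?_
    rw [smul_smul]
    ring_nf

lemma continuous_nsq_rpow_mul_mul {s : ℝ} (hs : 0 < s) (j k : Fin 3) :
    Continuous fun y : Fin 3 → ℝ => nsq y ^ (s / 2 - 1) * y j * y k := by
  refine continuous_iff_continuousAt.2 fun y => ?_
  by_cases hy : nsq y = 0
  · have hb : ∀ z : Fin 3 → ℝ, ‖nsq z ^ (s / 2 - 1) * z j * z k‖ ≤ nsq z ^ (s / 2) := by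
      intro z
      by_cases hz : nsq z = 0
      · have hz' := nsq_eq_zero.1 hz
        simp [hz', Real.rpow_nonneg (nsq_nonneg _)]
      · have hz0 : 0 < nsq z := lt_of_le_of_ne (nsq_nonneg z) (Ne.symm hz)
        have e : nsq z ^ (s / 2) = nsq z ^ (s / 2 - 1) * nsq z := by
          rw [← Real.rpow_add_one hz]; ring_nf
        rw [e, mul_assoc, norm_mul, Real.norm_of_nonneg (Real.rpow_nonneg hz0.le _)]
        refine mul_le_mul_of_nonneg_left ?_ (Real.rpow_nonneg hz0.le _)
        rw [Real.norm_eq_abs, abs_le]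
        have h1 := sq_le_nsq z j
        have h2 := sq_le_nsq z k
        constructor <;> nlinarith [sq_nonneg (z j - z k), sq_nonneg (z j + z k)]
    have ht : Filter.Tendsto (fun z => nsq z ^ (s / 2)) (nhds y) (nhds 0) := by
      have : ContinuousAt (fun z => nsq z ^ (s / 2)) y :=
        continuous_nsq.continuousAt.rpow_const (Or.inr (by positivity))
      simpa [ContinuousAt, hy, Real.zero_rpow (by positivity : s / 2 ≠ 0)] using this
    have := squeeze_zero_norm hb ht
    have hy' := nsq_eq_zero.1 hy
    simpa [ContinuousAt, hy'] using this
  · exact ((continuous_nsq.continuousAt.rpow_const (Or.inl hy)).mul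
      (continuous_apply j).continuousAt).mul (continuous_apply k).continuousAt

/-- The derivative of `y ↦ |y|^s y_j`, with the conventions of `Real.rpow` at `y = 0`. -/
lemma hasFDerivAt_nsq_rpow_mul {s : ℝ} (hs : 0 ≤ s) (j : Fin 3) (y : Fin 3 → ℝ) :
    HasFDerivAt (fun y => nsq y ^ (s / 2) * y j)
      (nsq y ^ (s / 2) • ContinuousLinearMap.proj (R := ℝ) (φ := fun _ : Fin 3 => ℝ) j
        + ∑ k, (s * (nsq y ^ (s / 2 - 1) * y j * y k)) •
            ContinuousLinearMap.proj (R := ℝ) (φ := fun _ : Fin 3 => ℝ) k) y := by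
  rcases hs.eq_or_lt with rfl | hs
  · simpa using hasFDerivAt_apply j y
  by_cases hy : nsq y = 0
  · have hy' := nsq_eq_zero.1 hy
    subst hy'
    have h0 : (0 : ℝ) ^ (s / 2) = 0 := Real.zero_rpow (by positivity)
    simp only [hy, h0, Pi.zero_apply, mul_zero, zero_smul, Finset.sum_const_zero, add_zero]
    refine .of_isLittleO ?_
    simp only [hy, Pi.zero_apply, mul_zero, sub_zero, _root_.zero_apply]
    have ht : Filter.Tendsto (fun z => nsq z ^ (s / 2)) (nhds 0) (nhds 0) := by
      have : ContinuousAt (fun z => nsq z ^ (s / 2)) 0 :=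
        continuous_nsq.continuousAt.rpow_const (Or.inr (by positivity))
      simpa [ContinuousAt, hy, h0] using this
    have h1 := (Asymptotics.isLittleO_one_iff ℝ).2 ht
    have h2 : (fun z : Fin 3 → ℝ => z j) =O[nhds 0] fun z => z :=
      Asymptotics.isBigO_of_le _ fun z => norm_le_pi_norm z j
    have := h1.mul_isBigO h2.norm_right
    simp only [one_mul] at this
    exact this.of_norm_right
  · have h := ((hasFDerivAt_nsq y).rpow_const (p := s / 2) (Or.inl hy)).mul
      ((ContinuousLinearMap.proj (R := ℝ) (φ := fun _ : Fin 3 => ℝ) j).hasFDerivAt (x := y))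
    refine h.congr_fderiv ?_
    simp only [Finset.smul_sum, smul_smul, ContinuousLinearMap.proj_apply]
    congr 1
    refine Finset.sum_congr rfl fun k _ => ?_
    ring_nf

lemma contDiff_nsq_rpow_mul {s : ℝ} (hs : 0 ≤ s) (j : Fin 3) :
    ContDiff ℝ 1 fun y => nsq y ^ (s / 2) * y j := by
  rw [contDiff_one_iff_fderiv]
  refine ⟨fun y => (hasFDerivAt_nsq_rpow_mul hs j y).differentiableAt, ?_⟩
  simp only [funext fun y => (hasFDerivAt_nsq_rpow_mul hs j y).fderiv]
  refine Continuous.add (Continuous.fun_smul ?_ continuous_const)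
    (continuous_finsetSum _ fun k _ => Continuous.fun_smul ?_ continuous_const)
  · exact continuous_nsq.rpow_const fun _ => Or.inr (by positivity)
  · rcases hs.eq_or_lt with rfl | hs
    · simpa using continuous_const
    · exact continuous_const.mul (continuous_nsq_rpow_mul_mul hs j k)

section PartialDerivatives

variable {f g : Sp → ℝ} {x : Sp} (i : Fin 3)

lemma pd_mul (hf : DifferentiableAt ℝ f x) (hg : DifferentiableAt ℝ g x) :
    pd i (fun y => f y * g y) x = pd i f x * g x + f x * pd i g x := by
  unfold pd
  rw [fderiv_fun_mul hf hg]
  simp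
  ring

lemma pd_sub (hf : DifferentiableAt ℝ f x) (hg : DifferentiableAt ℝ g x) :
    pd i (fun y => f y - g y) x = pd i f x - pd i g x := by
  unfold pd
  rw [fderiv_fun_sub hf hg]
  simp

lemma pd_const_mul (c : ℝ) (hf : DifferentiableAt ℝ f x) :
    pd i (fun y => c * f y) x = c * pd i f x := by
  unfold pd
  rw [fderiv_const_mul hf]
  simp

lemma pd_sum {F : Fin 3 → Sp → ℝ} (hF : ∀ j, DifferentiableAt ℝ (F j) x) :
    pd i (fun y => ∑ j, F j y) x = ∑ j, pd i (F j) x := by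
  unfold pd
  rw [fderiv_fun_sum fun j _ => hF j]
  simp

lemma contDiff_pd (hf : ContDiff ℝ (⊤ : ℕ∞) f) : ContDiff ℝ (⊤ : ℕ∞) (pd i f) :=
  (hf.fderiv_right (m := (⊤ : ℕ∞)) (by simp)).clm_apply contDiff_const

lemma ContDiff.continuous_pd (hf : ContDiff ℝ 1 f) : Continuous (pd i f) :=
  (hf.continuous_fderiv one_ne_zero).clm_apply continuous_const

lemma Periodic3.pd (hf : Periodic3 f) : Periodic3 (pd i f) := by
  intro x k
  unfold _root_.pd
  rw [← fderiv_comp_add_right, show (fun y => f (y + fun i => (k i : ℝ))) = f from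
    funext fun y => hf y k]

lemma pd_comp {G : (Fin 3 → ℝ) → ℝ} {v : Sp → Fin 3 → ℝ} {G' : (Fin 3 → ℝ) →L[ℝ] ℝ}
    (hG : HasFDerivAt G G' (v x)) (hv : ∀ j, DifferentiableAt ℝ (fun y => v y j) x) :
    pd i (fun y => G (v y)) x = G' (fun j => pd i (fun y => v y j) x) := by
  have hv' : HasFDerivAt v (ContinuousLinearMap.pi fun j => fderiv ℝ (fun y => v y j) x) x :=
    hasFDerivAt_pi'.2 fun j => (hv j).hasFDerivAt
  unfold pd
  have hc : HasFDerivAt (fun y => G (v y)) _ x := hG.comp x hv'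
  rw [hc.fderiv]
  rfl

end PartialDerivatives

section Balance

variable {ν κ γ T : ℝ} {u : ℝ → Sp → Fin 3 → ℝ} {θ : ℝ → Sp → ℝ}

namespace ThermalBurgers

lemma contDiff_u (h : ThermalBurgers ν κ γ T u θ) (t : ℝ) (j : Fin 3) :
    ContDiff ℝ (⊤ : ℕ∞) fun x => u t x j := by
  have := h.smooth_u.comp (contDiff_prodMk_right (n := (⊤ : ℕ∞)) (𝕜 := ℝ) (F := Sp) t)
  exact contDiff_pi.1 this j

lemma contDiff_u' (h : ThermalBurgers ν κ γ T u θ) (t : ℝ) :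
    ContDiff ℝ (⊤ : ℕ∞) (u t) := contDiff_pi.2 (h.contDiff_u t)

lemma contDiff_θ (h : ThermalBurgers ν κ γ T u θ) (t : ℝ) : ContDiff ℝ (⊤ : ℕ∞) (θ t) :=
  h.smooth_θ.comp (contDiff_prodMk_right (n := (⊤ : ℕ∞)) (𝕜 := ℝ) (F := Sp) t)

lemma hasDerivAt_u (h : ThermalBurgers ν κ γ T u θ) (t : ℝ) (x : Sp) (j : Fin 3) :
    HasDerivAt (fun s => u s x j) (deriv (fun s => u s x j) t) t := by
  have := contDiff_pi.1 (h.smooth_u.comp (contDiff_prodMk_left (n := (⊤ : ℕ∞)) (𝕜 := ℝ) (E := ℝ) x)) j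
  exact (this.differentiable (by simp) t).hasDerivAt

lemma hasDerivAt_θ (h : ThermalBurgers ν κ γ T u θ) (t : ℝ) (x : Sp) :
    HasDerivAt (fun s => θ s x) (deriv (fun s => θ s x) t) t := by
  have := h.smooth_θ.comp (contDiff_prodMk_left (n := (⊤ : ℕ∞)) (𝕜 := ℝ) (E := ℝ) x)
  exact (this.differentiable (by simp) t).hasDerivAt

lemma continuous_gradSqV (h : ThermalBurgers ν κ γ T u θ) (t : ℝ) :
    Continuous (gradSqV (u t)) :=
  continuous_finsetSum _ fun i _ => continuous_finsetSum _ fun j _ =>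
    (contDiff_pd i (h.contDiff_u t j)).continuous.pow 2

end ThermalBurgers

lemma continuous_deriv_slice {f : ℝ × Sp → ℝ} (hf : ContDiff ℝ 1 f) (t : ℝ) :
    Continuous fun x => deriv (fun s => f (s, x)) t := by
  have hder : ∀ x, deriv (fun s => f (s, x)) t = fderiv ℝ f (t, x) (1, 0) := fun x =>
    (((hf.differentiable one_ne_zero (t, x)).hasFDerivAt).comp_hasDerivAt t
      ((hasDerivAt_id t).prodMk (hasDerivAt_const t x))).deriv
  simp only [hder]
  exact ((hf.continuous_fderiv one_ne_zero).clm_apply continuous_const).comp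
    (by fun_prop : Continuous fun x : Sp => (t, x))

/-- Balance law for the temperature: the total heat grows at the rate of viscous heating. -/
lemma ThermalBurgers.hasDerivAt_heat (h : ThermalBurgers ν κ γ T u θ) {t : ℝ}
    (ht : t ∈ Set.Icc (0 : ℝ) T) :
    HasDerivAt (fun s => ∫ x in cell, θ s x ^ 2)
      (ν * ∫ x in cell, θ t x * gradSqV (u t) x) t := by
  have hf : ContDiff ℝ 1 fun q : ℝ × Sp => θ q.1 q.2 ^ 2 := (h.smooth_θ.pow 2).of_le (by simp)
  have hθ := h.contDiff_θ t
  have hu := h.contDiff_u t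
  have hθ2 : ContDiff ℝ (⊤ : ℕ∞) fun y => θ t y ^ 2 := hθ.pow 2
  have hA : ∀ i, ContDiff ℝ (⊤ : ℕ∞) fun y => u t y i * θ t y ^ 2 := fun i => (hu i).mul hθ2
  have hB : ∀ i, ContDiff ℝ (⊤ : ℕ∞) fun y => θ t y * pd i (fun z => θ t z ^ 2) y := fun i =>
    hθ.mul (contDiff_pd i hθ2)
  have hpθ2 : Periodic3 fun y => θ t y ^ 2 := fun x k =>
    congrArg (fun r => r ^ 2) (h.periodic_θ t x k)
  have hdiv := integral_cell_div_eq_zero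
    (fun i y => u t y i * θ t y ^ 2 - κ * (θ t y * pd i (fun z => θ t z ^ 2) y))
    (fun i => ((hA i).sub (contDiff_const.mul (hB i))).of_le (by simp))
    (fun i x k => by
      have h1 := h.periodic_u t i x k
      have h2 := h.periodic_θ t x k
      have h3 := hpθ2.pd i x k
      simp only at h1
      simp only [h1, h2, h3])
  have hpd : ∀ i x, pd i (fun y => u t y i * θ t y ^ 2 - κ * (θ t y * pd i (fun z => θ t z ^ 2) y)) x
      = pd i (fun y => u t y i * θ t y ^ 2) x
        - κ * pd i (fun y => θ t y * pd i (fun z => θ t z ^ 2) y) x := fun i x => by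
    have dA := (hA i).differentiable (by simp) x
    have dB := (hB i).differentiable (by simp) x
    rw [pd_sub i dA (dB.const_mul κ), pd_const_mul i κ dB]
  refine (hasDerivAt_integral_cell _ hf t).congr_deriv ?_
  rw [← integral_const_mul, ← add_zero (∫ x in cell, deriv _ t), ← hdiv, ← integral_add]
  · refine integral_congr_ae (ae_of_all _ fun x => ?_)
    have := h.heat t ht x
    simp only [hpd, Finset.sum_sub_distrib, ← Finset.mul_sum]
    linear_combination this
  · exact Continuous.integrableOn_cell (continuous_deriv_slice hf t)
  · simp only [hpd]
    exact Continuous.integrableOn_cell (continuous_finsetSum _ fun i _ =>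
      (contDiff_pd i (hA i)).continuous.sub (continuous_const.mul (contDiff_pd i (hB i)).continuous))

/-- Balance inequality for the `L^p` norm of the velocity. -/
lemma ThermalBurgers.hasDerivAt_Lp (h : ThermalBurgers ν κ γ T u θ) (hν : 0 < ν) {p : ℝ}
    (hp : 2 ≤ p) {t : ℝ} (ht : t ∈ Set.Icc (0 : ℝ) T) (hθ0 : ∀ x, 0 ≤ θ t x) :
    ∃ d, HasDerivAt (fun s => ∫ x in cell, nsq (u s x) ^ (p / 2)) d t ∧
      d ≤ (1 - p / γ) * (∫ x in cell, nsq (u t x) ^ (p / 2) * ∑ i, pd i (fun y => u t y i) x)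
        - ν * p * ∫ x in cell, θ t x * (nsq (u t x) ^ (p / 2 - 1) * gradSqV (u t) x) := by
  have hfp : ContDiff ℝ 1 fun y => nsq y ^ (p / 2) := contDiff_nsq_rpow (by linarith)
  have hf : ContDiff ℝ 1 fun q : ℝ × Sp => nsq (u q.1 q.2) ^ (p / 2) :=
    hfp.comp (h.smooth_u.of_le (by simp))
  refine ⟨_, hasDerivAt_integral_cell _ hf t, ?_⟩
  have hs : 0 ≤ p - 2 := by linarith
  have hθ := h.contDiff_θ t
  have hu := h.contDiff_u t
  have hF : ContDiff ℝ 1 fun x => nsq (u t x) ^ (p / 2) :=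
    hfp.comp ((h.contDiff_u' t).of_le (by simp))
  have hN : ∀ j, ContDiff ℝ 1 fun x => nsq (u t x) ^ ((p - 2) / 2) * u t x j := fun j =>
    (contDiff_nsq_rpow_mul hs j).comp ((h.contDiff_u' t).of_le (by simp))
  have hB : ∀ i j, ContDiff ℝ (⊤ : ℕ∞) fun y => θ t y * pd i (fun z => u t z j) y := fun i j =>
    hθ.mul (contDiff_pd i (hu j))
  have hB1 : ∀ i j, ContDiff ℝ 1 fun y => θ t y * pd i (fun z => u t z j) y := fun i j =>
    (hB i j).of_le (by simp)
  have hu1 : ∀ j, ContDiff ℝ 1 fun y => u t y j := fun j => (hu j).of_le (by simp)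
  have hV : ∀ i, ContDiff ℝ 1 fun y => u t y i * nsq (u t y) ^ (p / 2)
      - ν * p * ∑ j, nsq (u t y) ^ ((p - 2) / 2) * u t y j * (θ t y * pd i (fun z => u t z j) y) :=
    fun i => ((hu1 i).mul hF).sub (contDiff_const.mul
      (ContDiff.sum fun j _ => (hN j).mul (hB1 i j)))
  have hdiv := integral_cell_div_eq_zero
    (fun i y => u t y i * nsq (u t y) ^ (p / 2)
      - ν * p * ∑ j, nsq (u t y) ^ ((p - 2) / 2) * u t y j * (θ t y * pd i (fun z => u t z j) y))
    hV
    (fun i x k => by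
      have h1 : ∀ j, u t (x + fun i => (k i : ℝ)) j = u t x j := fun j => h.periodic_u t j x k
      have h1' := funext h1
      have h2 := h.periodic_θ t x k
      have h3 : ∀ j, _ := fun j => (h.periodic_u t j).pd i x k
      simp only [h1', h2, h3])
  have hRc : Continuous fun x => (1 - p / γ) *
      (nsq (u t x) ^ (p / 2) * ∑ i, pd i (fun y => u t y i) x) :=
    continuous_const.mul (hF.continuous.mul
      (continuous_finsetSum _ fun i _ => (contDiff_pd i (hu i)).continuous))
  have hGc : Continuous fun x => ν * p *
      (θ t x * (nsq (u t x) ^ (p / 2 - 1) * gradSqV (u t) x)) :=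
    continuous_const.mul (hθ.continuous.mul
      (((continuous_nsq.comp (h.contDiff_u' t).continuous).rpow_const
        fun _ => Or.inr (by linarith)).mul (h.continuous_gradSqV t)))
  have hVc := continuous_finsetSum Finset.univ fun i (_ : i ∈ Finset.univ) =>
    (hV i).continuous_pd i
  have hdc := continuous_deriv_slice hf t
  rw [← integral_const_mul, ← integral_const_mul, ← add_zero (∫ x in cell, deriv _ t), ← hdiv,
    ← integral_add hdc.integrableOn_cell hVc.integrableOn_cell,
    ← integral_sub hRc.integrableOn_cell hGc.integrableOn_cell]
  refine integral_mono (hdc.add hVc).integrableOn_cell (hRc.sub hGc).integrableOn_cell fun x => ?_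
  have du : ∀ j, DifferentiableAt ℝ (fun y => u t y j) x := fun j =>
    (hu j).differentiable (by simp) x
  have dF := hF.differentiable one_ne_zero x
  have dN := fun j => (hN j).differentiable one_ne_zero x
  have dB := fun i j => (hB1 i j).differentiable one_ne_zero x
  have eV : ∀ i, pd i (fun y => u t y i * nsq (u t y) ^ (p / 2)
      - ν * p * ∑ j, nsq (u t y) ^ ((p - 2) / 2) * u t y j * (θ t y * pd i (fun z => u t z j) y)) x
      = pd i (fun y => u t y i) x * nsq (u t x) ^ (p / 2)
        + u t x i * pd i (fun y => nsq (u t y) ^ (p / 2)) x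
        - ν * p * ∑ j, (pd i (fun y => nsq (u t y) ^ ((p - 2) / 2) * u t y j) x
              * (θ t x * pd i (fun z => u t z j) x)
            + nsq (u t x) ^ ((p - 2) / 2) * u t x j
              * pd i (fun y => θ t y * pd i (fun z => u t z j) y) x) := fun i => by
    rw [pd_sub i ((du i).fun_mul dF) ((DifferentiableAt.fun_sum fun j _ => (dN j).fun_mul (dB i j)).const_mul _),
      pd_mul i (du i) dF,
      pd_const_mul i _ (DifferentiableAt.fun_sum fun j _ => (dN j).fun_mul (dB i j)),
      pd_sum i fun j => (dN j).fun_mul (dB i j)]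
    simp only [pd_mul i (dN _) (dB i _)]
  have eF : ∀ i, pd i (fun y => nsq (u t y) ^ (p / 2)) x
      = p * nsq (u t x) ^ (p / 2 - 1) * ∑ k, u t x k * pd i (fun y => u t y k) x := fun i => by
    rw [pd_comp i (hasFDerivAt_nsq_rpow (by linarith) (u t x)) du]
    simp [Fin.sum_univ_three]
    ring
  have eN : ∀ i j, pd i (fun y => nsq (u t y) ^ ((p - 2) / 2) * u t y j) x
      = nsq (u t x) ^ ((p - 2) / 2) * pd i (fun y => u t y j) x
        + (p - 2) * nsq (u t x) ^ ((p - 2) / 2 - 1) * u t x j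
          * ∑ k, u t x k * pd i (fun y => u t y k) x := fun i j => by
    rw [pd_comp i (hasFDerivAt_nsq_rpow_mul hs j (u t x)) du]
    simp [Fin.sum_univ_three]
    ring
  have et : deriv (fun s => nsq (u s x) ^ (p / 2)) t
      = p * nsq (u t x) ^ (p / 2 - 1) * ∑ k, u t x k * deriv (fun s => u s x k) t := by
    have := (hasFDerivAt_nsq_rpow (a := p / 2) (by linarith) (u t x)).comp_hasDerivAt t
      (hasDerivAt_pi.2 fun j => h.hasDerivAt_u t x j)
    rw [HasDerivAt.deriv (f := fun s => nsq (u s x) ^ (p / 2)) this]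
    simp [Fin.sum_univ_three]
    ring
  have hm := h.momentum t ht x
  have hes : (p - 2) / 2 = p / 2 - 1 := by ring
  have hq : nsq (u t x) ^ (p / 2) = nsq (u t x) ^ (p / 2 - 1) * nsq (u t x) := by
    rw [← Real.rpow_add_one' (nsq_nonneg _) (by linarith)]
    ring_nf
  change deriv (fun s => nsq (u s x) ^ (p / 2)) t + ∑ i, pd i (fun y => u t y i * nsq (u t y) ^ (p / 2)
      - ν * p * ∑ j, nsq (u t y) ^ ((p - 2) / 2) * u t y j * (θ t y * pd i (fun z => u t z j) y)) x
      ≤ (1 - p / γ) * (nsq (u t x) ^ (p / 2) * ∑ i, pd i (fun y => u t y i) x)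
        - ν * p * (θ t x * (nsq (u t x) ^ (p / 2 - 1) * gradSqV (u t) x))
  simp only [eV, eF, eN, et]
  simp only [hes, hq]
  have hz : 0 ≤ (p - 2) * nsq (u t x) ^ (p / 2 - 1 - 1) := mul_nonneg hs (Real.rpow_nonneg (nsq_nonneg _) _)
  generalize nsq (u t x) ^ (p / 2 - 1 - 1) = z at *
  generalize nsq (u t x) ^ (p / 2 - 1) = r at *
  have hpos : 0 ≤ ν * p * θ t x * ((p - 2) * z) * ∑ i, (∑ k, u t x k * pd i (fun y => u t y k) x) ^ 2 := by
    have := hθ0 x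
    have : 0 ≤ ∑ i, (∑ k, u t x k * pd i (fun y => u t y k) x) ^ 2 :=
      Finset.sum_nonneg fun _ _ => sq_nonneg _
    positivity
  have hm0 := hm 0
  have hm1 := hm 1
  have hm2 := hm 2
  simp only [gradSqV, nsq, Fin.sum_univ_three, Fin.isValue] at hm0 hm1 hm2 hpos ⊢
  refine sub_nonneg.1 (hpos.trans_eq ?_)
  linear_combination (p * r * u t x 0) * hm0 + (p * r * u t x 1) * hm1 + (p * r * u t x 2) * hm2

end Balance

section MinimumPrinciple

/-- Every point has a representative in the fundamental cell. -/
lemma exists_mem_cell (x : Sp) : ∃ y ∈ cell, ∀ f : Sp → ℝ, Periodic3 f → f y = f x := by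
  refine ⟨fun i => Int.fract (x i), ⟨fun i => Int.fract_nonneg _, fun i => (Int.fract_lt_one _).le⟩,
    fun f hf => ?_⟩
  rw [← hf (fun i => Int.fract (x i)) fun i => ⌊x i⌋]
  congr 1
  funext i
  exact Int.fract_add_floor (x i)

lemma pd_eq_zero_of_forall_le {f : Sp → ℝ} {x : Sp} (hx : ∀ y, f x ≤ f y) (i : Fin 3) :
    pd i f x = 0 := by
  have h : IsLocalMin f x := Filter.Eventually.of_forall hx
  simp [pd, h.fderiv_eq_zero]

lemma deriv_line {f : Sp → ℝ} (hf : Differentiable ℝ f) (x : Sp) (i : Fin 3) :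
    deriv (fun s : ℝ => f (x + s • Pi.single i 1)) = fun s => pd i f (x + s • Pi.single i 1) := by
  funext s
  have h1 : HasDerivAt (fun s : ℝ => x + s • (Pi.single i 1 : Sp)) (Pi.single i 1) s := by
    simpa using ((hasDerivAt_id s).smul_const (Pi.single i 1 : Sp)).const_add x
  exact ((hf _).hasFDerivAt.comp_hasDerivAt s h1).deriv

/-- Second order necessary condition for a minimum, in a coordinate direction. -/
lemma pd_pd_nonneg_of_forall_le {f : Sp → ℝ} (hf : ContDiff ℝ (⊤ : ℕ∞) f) {x : Sp}
    (hx : ∀ y, f x ≤ f y) (i : Fin 3) : 0 ≤ pd i (pd i f) x := by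
  by_contra! hneg
  have hd := deriv_line (hf.differentiable (by simp)) x i
  have hdd := deriv_line ((contDiff_pd i hf).differentiable (by simp)) x i
  have h1 : deriv (fun s : ℝ => f (x + s • Pi.single i 1)) 0 = 0 := by
    simp [hd, pd_eq_zero_of_forall_le hx]
  have h2 : deriv (deriv (fun s : ℝ => f (x + s • Pi.single i 1))) 0 < 0 := by
    simpa [hd, hdd] using hneg
  have hc : ContinuousAt (fun s : ℝ => f (x + s • Pi.single i 1)) 0 :=
    (hf.continuous.comp (by fun_prop)).continuousAt
  have hmax := isLocalMax_of_deriv_deriv_neg h2 h1 hc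
  have hconst : (fun s : ℝ => f (x + s • Pi.single i 1)) =ᶠ[nhds 0] fun _ => f x := by
    filter_upwards [hmax] with s hs
    simp only [zero_smul, add_zero] at hs
    exact le_antisymm hs (hx _)
  have := hconst.deriv.deriv_eq
  simp only [deriv_const'] at this
  simp [this] at h2

variable {ν κ γ T : ℝ} {u : ℝ → Sp → Fin 3 → ℝ} {θ : ℝ → Sp → ℝ}

/-- At a positive spatial minimum the square root of the temperature decreases at most
quadratically fast. -/
lemma ThermalBurgers.deriv_θ_lower (h : ThermalBurgers ν κ γ T u θ) (hν : 0 < ν) (hκ : 0 < κ)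
    {t : ℝ} (ht : t ∈ Set.Icc (0 : ℝ) T) {x : Sp} (hx : ∀ y, θ t x ≤ θ t y) (hpos : 0 < θ t x) :
    -(3 / (8 * ν)) * θ t x ^ 2 ≤ deriv (fun s => θ s x) t := by
  have hθ := h.contDiff_θ t
  have hθ1 : Differentiable ℝ (θ t) := hθ.differentiable (by simp)
  have hp1 : ∀ i, Differentiable ℝ (pd i (θ t)) := fun i =>
    (contDiff_pd i hθ).differentiable (by simp)
  have hu1 : ∀ i, DifferentiableAt ℝ (fun y => u t y i) x := fun i =>
    (h.contDiff_u t i).differentiable (by simp) x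
  have h0 : ∀ i, pd i (θ t) x = 0 := pd_eq_zero_of_forall_le hx
  have hsq : ∀ i y, pd i (fun z => θ t z ^ 2) y = 2 * (θ t y * pd i (θ t) y) := fun i y => by
    simp only [pow_two]
    rw [pd_mul i (hθ1 y) (hθ1 y)]
    ring
  have hh := h.heat t ht x
  have e1 : ∀ i, pd i (fun y => u t y i * θ t y ^ 2) x = pd i (fun y => u t y i) x * θ t x ^ 2 :=
    fun i => by rw [pd_mul i (hu1 i) ((hθ1 x).fun_pow 2), hsq, h0]; ring
  have e2 : ∀ i, pd i (fun y => θ t y * pd i (fun z => θ t z ^ 2) y) x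
      = 2 * θ t x ^ 2 * pd i (pd i (θ t)) x := fun i => by
    simp only [hsq]
    have d1 : DifferentiableAt ℝ (fun y => θ t y * pd i (θ t) y) x := (hθ1 x).fun_mul (hp1 i x)
    rw [pd_mul i (hθ1 x) (d1.const_mul 2), pd_const_mul i 2 d1, pd_mul i (hθ1 x) (hp1 i x), h0]
    ring
  have e3 : deriv (fun s => θ s x ^ 2) t = 2 * θ t x * deriv (fun s => θ s x) t := by
    rw [((h.hasDerivAt_θ t x).fun_pow 2).deriv]
    ring
  have e4 : ∀ i, 0 ≤ pd i (pd i (θ t)) x := pd_pd_nonneg_of_forall_le hθ hx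
  simp only [e1, e2, e3, gradSqV, Fin.sum_univ_three] at hh
  have e5 := mul_nonneg (mul_nonneg hκ.le hpos.le) (add_nonneg (add_nonneg (e4 0) (e4 1)) (e4 2))
  generalize deriv (fun s => θ s x) t = τ at *
  generalize θ t x = a at *
  have hh' : 2 * τ = ν * (∑ i, ∑ j, pd i (fun y => u t y j) x ^ 2)
      - a * ∑ i, pd i (fun y => u t y i) x + 2 * (κ * a * ∑ i, pd i (pd i (θ t)) x) := by
    have : a ≠ 0 := hpos.ne'
    simp only [Fin.sum_univ_three]
    apply mul_left_cancel₀ this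
    linear_combination hh
  simp only [Fin.sum_univ_three] at hh'
  have key : 0 ≤ 8 * ν * τ + 3 * a ^ 2 := by
    have : 8 * ν * τ = 4 * ν * (2 * τ) := by ring
    rw [this, hh']
    have e6 := mul_nonneg hν.le e5
    nlinarith [sq_nonneg (2 * ν * pd 0 (fun y => u t y 0) x - a),
      sq_nonneg (2 * ν * pd 1 (fun y => u t y 1) x - a),
      sq_nonneg (2 * ν * pd 2 (fun y => u t y 2) x - a),
      sq_nonneg (ν * pd 0 (fun y => u t y 1) x), sq_nonneg (ν * pd 0 (fun y => u t y 2) x),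
      sq_nonneg (ν * pd 1 (fun y => u t y 0) x), sq_nonneg (ν * pd 1 (fun y => u t y 2) x),
      sq_nonneg (ν * pd 2 (fun y => u t y 0) x), sq_nonneg (ν * pd 2 (fun y => u t y 1) x)]
  rw [neg_mul, neg_le_iff_add_nonneg, div_mul_eq_mul_div, ← sub_nonneg]
  have : τ + 3 * a ^ 2 / (8 * ν) - 0 = (8 * ν * τ + 3 * a ^ 2) / (8 * ν) := by field_simp; ring
  rw [this]
  positivity

/-- Minimum principle: the square root of the temperature decays at most like `1 / t`. -/
lemma ThermalBurgers.half_le_mul_θ (h : ThermalBurgers ν κ γ T u θ) (hν : 0 < ν) (hκ : 0 < κ)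
    {t : ℝ} (ht : t ∈ Set.Icc (0 : ℝ) T) (x : Sp) : 1 / 2 ≤ (1 + 3 / (8 * ν) * t) * θ t x := by
  set c := 3 / (8 * ν) with hc
  have hcpos : 0 < c := by positivity
  by_contra! hcon
  obtain ⟨y, hy, hyx⟩ := exists_mem_cell x
  have hcont : Continuous fun q : ℝ × Sp => (1 + c * q.1) * θ q.1 q.2 :=
    (by fun_prop : Continuous fun q : ℝ × Sp => 1 + c * q.1).mul h.smooth_θ.continuous
  have hK : IsCompact ((Set.Icc (0 : ℝ) T ×ˢ cell) ∩
      {q : ℝ × Sp | (1 + c * q.1) * θ q.1 q.2 ≤ 1 / 2}) :=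
    (isCompact_Icc.prod isCompact_Icc).inter_right (isClosed_le hcont continuous_const)
  obtain ⟨⟨s, z⟩, ⟨⟨hs, hz⟩, hsz⟩, hmin⟩ := hK.exists_isMinOn
    ⟨(t, y), ⟨ht, hy⟩, by simpa [hyx _ (h.periodic_θ t)] using hcon.le⟩ continuous_fst.continuousOn
  simp only [Set.mem_ofPred_eq] at hsz hs hz
  have hbefore : ∀ r ∈ Set.Ico 0 s, ∀ x, 1 / 2 ≤ (1 + c * r) * θ r x := by
    intro r hr x
    by_contra! hlt
    obtain ⟨y, hy, hyx⟩ := exists_mem_cell x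
    have := hmin (a := (r, y)) ⟨⟨⟨hr.1, hr.2.le.trans hs.2⟩, hy⟩, by
      simpa [hyx _ (h.periodic_θ r)] using hlt.le⟩
    exact absurd hr.2 (not_lt.2 this)
  have hs0 : 0 < s := by
    refine lt_of_le_of_ne hs.1 fun h0 => ?_
    subst h0
    have := h.θ0_ge_one z
    linarith
  have hev : ∀ᶠ r in nhdsWithin s (Set.Iio s), r ∈ Set.Ico 0 s := by
    filter_upwards [self_mem_nhdsWithin, nhdsWithin_le_nhds (lt_mem_nhds hs0)] with r h1 h2
    exact ⟨h2.le, h1⟩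
  have hall : ∀ x, 1 / 2 ≤ (1 + c * s) * θ s x := by
    intro x
    have hcx : Continuous fun r => (1 + c * r) * θ r x :=
      hcont.comp (by fun_prop : Continuous fun r : ℝ => (r, x))
    exact ge_of_tendsto (hcx.continuousAt.continuousWithinAt.tendsto) (hev.mono fun r hr => hbefore r hr x)
  have heq : (1 + c * s) * θ s z = 1 / 2 := le_antisymm hsz (hall z)
  have hfac : 0 < 1 + c * s := by positivity
  have hzmin : ∀ y, θ s z ≤ θ s y := fun y =>
    le_of_mul_le_mul_left (heq.le.trans (hall y)) hfac
  have hpos : 0 < θ s z := by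
    by_contra! hle
    nlinarith [mul_nonneg hfac.le (neg_nonneg.2 hle)]
  have hlow := h.deriv_θ_lower hν hκ hs hzmin hpos
  have hder : HasDerivAt (fun r => (1 + c * r) * θ r z)
      (c * θ s z + (1 + c * s) * deriv (fun r => θ r z) s) s := by
    have h1 : HasDerivAt (fun r => 1 + c * r) c s := by
      simpa using ((hasDerivAt_id s).const_mul c).const_add 1
    exact h1.mul (h.hasDerivAt_θ s z)
  have hle : c * θ s z + (1 + c * s) * deriv (fun r => θ r z) s ≤ 0 := by
    have hsl := (hasDerivWithinAt_iff_tendsto_slope' (s := Set.Iio s) (by simp)).1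
      hder.hasDerivWithinAt
    refine le_of_tendsto hsl (hev.mono fun r hr => ?_)
    rw [slope_def_field, heq]
    exact div_nonpos_of_nonneg_of_nonpos (by linarith [hbefore r hr z]) (by linarith [hr.2])
  rw [← hc] at hlow
  have h3 := mul_le_mul_of_nonneg_left hlow hfac.le
  have h4 : (1 + c * s) * (-c * θ s z ^ 2) = - (c * θ s z) * (1 / 2) := by rw [← heq]; ring
  have h5 := mul_pos hcpos hpos
  linarith

end MinimumPrinciple

/-- A periodic function has on `[-1,2]³` at most `27` times its integral over the torus. -/
lemma lintegral_Icc_neg_one_two_le {g : Sp → ℝ} (hg : Continuous g) (hp : Periodic3 g) :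
    ∫⁻ x in Set.Icc (-1 : Sp) 2, ENNReal.ofReal (g x) ≤
      27 * ∫⁻ x in cell, ENNReal.ofReal (g x) := by
  let c : (Fin 3 → Fin 3) → Sp := fun k i => ((1 - (k i : ℕ) : ℤ) : ℝ)
  have hsub : Set.Icc (-1 : Sp) 2 ⊆ ⋃ k, (fun x => x + c k) ⁻¹' cell := by
    intro x hx
    have h : ∀ i, ∃ k : Fin 3, 0 ≤ x i + ((1 - (k : ℕ) : ℤ) : ℝ) ∧
        x i + ((1 - (k : ℕ) : ℤ) : ℝ) ≤ 1 := by
      intro i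
      have h1 : -1 ≤ x i := hx.1 i
      have h2 : x i ≤ 2 := hx.2 i
      rcases le_total (x i) 0 with h3 | h3
      · exact ⟨0, by norm_num; linarith, by norm_num; linarith⟩
      rcases le_total (x i) 1 with h4 | h4
      · exact ⟨1, by norm_num; linarith, by norm_num; linarith⟩
      · exact ⟨2, by norm_num; linarith, by norm_num; linarith⟩
    choose k hk using h
    exact Set.mem_iUnion.2 ⟨k, fun i => (hk i).1, fun i => (hk i).2⟩
  have htr : ∀ k, ∫⁻ x in (fun x => x + c k) ⁻¹' cell, ENNReal.ofReal (g x) =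
      ∫⁻ x in cell, ENNReal.ofReal (g x) := by
    intro k
    rw [← (measurePreserving_add_right volume (c k)).setLIntegral_comp_preimage (s := cell)
      measurableSet_Icc
      (by fun_prop : Measurable fun x => ENNReal.ofReal (g x))]
    refine lintegral_congr fun x => ?_
    rw [hp x fun i => (1 - (k i : ℕ) : ℤ)]
  calc _ ≤ ∫⁻ x in ⋃ k, (fun x => x + c k) ⁻¹' cell, ENNReal.ofReal (g x) :=
        lintegral_mono_set hsub
    _ ≤ ∑' k, ∫⁻ x in (fun x => x + c k) ⁻¹' cell, ENNReal.ofReal (g x) :=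
        lintegral_iUnion_le _ _
    _ = _ := by simp [htr, tsum_fintype]

lemma norm_fderiv_sq_le (w : Sp → ℝ) (x : Sp) : ‖fderiv ℝ w x‖ ^ 2 ≤ 3 * gradSqS w x := by
  have h : ‖fderiv ℝ w x‖ ≤ ∑ i, |pd i w x| := by
    refine ContinuousLinearMap.opNorm_le_bound _ (Finset.sum_nonneg fun _ _ => abs_nonneg _)
      fun v => ?_
    conv_lhs => rw [pi_eq_sum_univ' v]
    rw [map_sum, Finset.sum_mul]
    refine norm_sum_le_of_le _ fun i _ => ?_
    rw [map_smul, smul_eq_mul, norm_mul, mul_comm]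
    exact mul_le_mul_of_nonneg_left (norm_le_pi_norm v i) (abs_nonneg _)
  calc _ ≤ (∑ i, |pd i w x|) ^ 2 := by gcongr
    _ ≤ _ := by
      have := sq_sum_le_card_mul_sum_sq (s := Finset.univ) (f := fun i => |pd i w x|)
      simpa [gradSqS] using this

lemma exists_cutoff : ∃ χ : Sp → ℝ, ∃ M : ℝ, ContDiff ℝ 1 χ ∧ HasCompactSupport χ ∧
    (∀ x ∈ cell, χ x = 1) ∧ (∀ x, |χ x| ≤ 1) ∧ tsupport χ ⊆ Set.Icc (-1) 2 ∧
    ∀ x, ‖fderiv ℝ χ x‖ ≤ M := by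
  let χ : ContDiffBump (fun _ => 1 / 2 : Sp) := ⟨1 / 2, 3 / 2, by norm_num, by norm_num⟩
  have hc : ContDiff ℝ 1 χ := χ.contDiff
  obtain ⟨M, hM⟩ := (χ.hasCompactSupport.fderiv (𝕜 := ℝ)).exists_bound_of_continuous
    (hc.continuous_fderiv one_ne_zero)
  refine ⟨χ, M, hc, χ.hasCompactSupport, fun x hx => χ.one_of_mem_closedBall ?_,
    fun x => ?_, ?_, hM⟩
  · rw [Metric.mem_closedBall, dist_pi_le_iff (by norm_num [χ])]
    intro i
    have h1 : 0 ≤ x i := hx.1 i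
    have h2 : x i ≤ 1 := hx.2 i
    rw [Real.dist_eq, abs_le]
    constructor <;> simp only [χ] <;> linarith
  · rw [abs_of_nonneg χ.nonneg]
    exact χ.le_one
  · rw [χ.tsupport_eq]
    intro x hx
    rw [Metric.mem_closedBall, dist_pi_le_iff (by norm_num [χ])] at hx
    constructor <;> intro i <;> have := hx i <;> rw [Real.dist_eq, abs_le] at this <;>
      simp only [χ] at this <;> simp only [Pi.neg_apply, Pi.ofNat_apply] <;> linarith

lemma Periodic3.gradSqS {w : Sp → ℝ} (hp : Periodic3 w) : Periodic3 (gradSqS w) := fun x k => by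
  unfold _root_.gradSqS
  refine Finset.sum_congr rfl fun i _ => ?_
  rw [hp.pd i x k]

lemma ContDiff.continuous_gradSqS {w : Sp → ℝ} (hw : ContDiff ℝ 1 w) : Continuous (gradSqS w) :=
  continuous_finsetSum _ fun i _ => (hw.continuous_pd i).pow 2

lemma gradSqS_nonneg (w : Sp → ℝ) (x : Sp) : 0 ≤ gradSqS w x :=
  Finset.sum_nonneg fun _ _ => sq_nonneg _

/-- Sobolev embedding `H¹(𝕋³) ⊆ L⁶(𝕋³)`. -/
lemma exists_integral_pow_six_le : ∃ C : ℝ, 0 ≤ C ∧ ∀ w : Sp → ℝ, ContDiff ℝ 1 w → Periodic3 w →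
    ∫ x in cell, w x ^ 6 ≤ C * (∫ x in cell, (w x ^ 2 + gradSqS w x)) ^ 3 := by
  obtain ⟨χ, M, hχ, hχc, hχ1, hχle, hχs, hM⟩ := exists_cutoff
  let S : NNReal := SNormLESNormFDerivOfEqConst ℝ (volume : Measure Sp) (2 : NNReal)
  let A : ℝ := 6 + 2 * M ^ 2
  have hA : 0 ≤ A := by positivity
  refine ⟨S ^ 6 * (27 * A) ^ 3, by positivity, fun w hw hp => ?_⟩
  have hH : Continuous fun x => w x ^ 2 + gradSqS w x :=
    (hw.continuous.pow 2).add hw.continuous_gradSqS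
  have hH0 : ∀ x, 0 ≤ w x ^ 2 + gradSqS w x := fun x =>
    add_nonneg (sq_nonneg _) (gradSqS_nonneg w x)
  have hHp : Periodic3 fun x => A * (w x ^ 2 + gradSqS w x) := fun x k => by
    simp only [hp x k, hp.gradSqS x k]
  have hcd : ContDiff ℝ 1 fun x => χ x * w x := hχ.mul hw
  have hcs : HasCompactSupport fun x => χ x * w x := hχc.mul_right
  have hsob := eLpNorm_le_eLpNorm_fderiv_of_eq (μ := (volume : Measure Sp)) hcd hcs (p := 2)
    (p' := 6) (by norm_num) (by simp) (by simp; norm_num)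
  have hgrad : ∀ x, ‖fderiv ℝ (fun x => χ x * w x) x‖ₑ ^ (2 : ℝ) ≤
      (Set.Icc (-1 : Sp) 2).indicator
        (fun x => ENNReal.ofReal (A * (w x ^ 2 + gradSqS w x))) x := by
    intro x
    by_cases hx : x ∈ Set.Icc (-1 : Sp) 2
    · rw [Set.indicator_of_mem hx, ← ofReal_norm, ENNReal.ofReal_rpow_of_nonneg
        (norm_nonneg _) (by norm_num)]
      refine ENNReal.ofReal_le_ofReal ?_
      rw [Real.rpow_ofNat, fderiv_fun_mul (hχ.differentiable one_ne_zero x)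
        (hw.differentiable one_ne_zero x)]
      have h1 : ‖χ x • fderiv ℝ w x + w x • fderiv ℝ χ x‖ ≤ ‖fderiv ℝ w x‖ + M * |w x| := by
        refine (norm_add_le _ _).trans (add_le_add ?_ ?_)
        · rw [norm_smul]
          exact mul_le_of_le_one_left (norm_nonneg _) (hχle x)
        · rw [norm_smul, mul_comm]
          exact mul_le_mul_of_nonneg_right (hM x) (norm_nonneg _)
      have h2 := norm_fderiv_sq_le w x
      have h3 : (‖fderiv ℝ w x‖ + M * |w x|) ^ 2 ≤
          2 * ‖fderiv ℝ w x‖ ^ 2 + 2 * (M ^ 2 * w x ^ 2) := by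
        rw [← sq_abs (w x)]
        nlinarith [sq_nonneg (‖fderiv ℝ w x‖ - M * |w x|)]
      have h4 := gradSqS_nonneg w x
      calc _ ≤ (‖fderiv ℝ w x‖ + M * |w x|) ^ 2 := by gcongr
        _ ≤ _ := h3
        _ ≤ A * (w x ^ 2 + gradSqS w x) := by
          simp only [A]
          nlinarith [mul_nonneg (sq_nonneg M) h4, sq_nonneg (w x)]
    · have : x ∉ tsupport fun x => χ x * w x := fun h =>
        hx (hχs (tsupport_mul_subset_left h))
      rw [Set.indicator_of_notMem hx, ← ofReal_norm, fderiv_of_notMem_tsupport (𝕜 := ℝ) this, norm_zero]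
      simp
  have hI : ∫⁻ x, ‖fderiv ℝ (fun x => χ x * w x) x‖ₑ ^ (2 : ℝ) ≤
      ENNReal.ofReal (27 * A * ∫ x in cell, (w x ^ 2 + gradSqS w x)) := by
    calc _ ≤ _ := lintegral_mono hgrad
      _ = ∫⁻ x in Set.Icc (-1 : Sp) 2, ENNReal.ofReal (A * (w x ^ 2 + gradSqS w x)) :=
        lintegral_indicator measurableSet_Icc _
      _ ≤ 27 * ∫⁻ x in cell, ENNReal.ofReal (A * (w x ^ 2 + gradSqS w x)) :=
        lintegral_Icc_neg_one_two_le (hH.const_mul A) hHp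
      _ = _ := by
        rw [← ofReal_integral_eq_lintegral_ofReal (Continuous.integrableOn_cell (hH.const_mul A))
          (ae_of_all _ fun x => mul_nonneg hA (hH0 x)), integral_const_mul, mul_assoc,
          ENNReal.ofReal_mul (p := 27) (by norm_num)]
        norm_num
  have h6 : ENNReal.ofReal (∫ x in cell, w x ^ 6) ≤ ENNReal.ofReal (S ^ 6 * (27 * A) ^ 3 *
      (∫ x in cell, (w x ^ 2 + gradSqS w x)) ^ 3) := by
    calc _ = ∫⁻ x in cell, ENNReal.ofReal (w x ^ 6) :=
          ofReal_integral_eq_lintegral_ofReal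
            (Continuous.integrableOn_cell (hw.continuous.pow 6))
            (ae_of_all _ fun x => by positivity)
      _ = ∫⁻ x in cell, ‖χ x * w x‖ₑ ^ (6 : ℝ) := by
          refine setLIntegral_congr_fun measurableSet_Icc fun x hx => ?_
          rw [hχ1 x hx, one_mul, ← ofReal_norm, ENNReal.ofReal_rpow_of_nonneg
            (norm_nonneg _) (by norm_num), Real.rpow_ofNat, Real.norm_eq_abs,
            Even.pow_abs (by decide)]
      _ ≤ ∫⁻ x, ‖χ x * w x‖ₑ ^ (6 : ℝ) := setLIntegral_le_lintegral _ _
      _ = eLpNorm (fun x => χ x * w x) (6 : NNReal) volume ^ (6 : ℝ) := by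
          rw [← NNReal.coe_ofNat, eLpNorm_nnreal_pow_eq_lintegral (by norm_num)]
      _ ≤ (S * eLpNorm (fderiv ℝ fun x => χ x * w x) (2 : NNReal) volume) ^ (6 : ℝ) := by
          gcongr
      _ = S ^ 6 * (∫⁻ x, ‖fderiv ℝ (fun x => χ x * w x) x‖ₑ ^ (2 : ℝ)) ^ 3 := by
          rw [← NNReal.coe_ofNat 2, ← eLpNorm_nnreal_pow_eq_lintegral (by norm_num)]
          simp only [NNReal.coe_ofNat, ENNReal.rpow_ofNat]
          ring
      _ ≤ S ^ 6 * (ENNReal.ofReal (27 * A * ∫ x in cell, (w x ^ 2 + gradSqS w x))) ^ 3 := by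
          gcongr
      _ = _ := by
          rw [mul_assoc (_ ^ 6), ← mul_pow, ENNReal.ofReal_mul (p := S ^ 6) (by positivity),
            ENNReal.ofReal_pow (mul_nonneg (by positivity)
              (integral_nonneg fun x => hH0 x)), ENNReal.ofReal_pow (by positivity),
            ENNReal.ofReal_coe_nnreal]
  exact (ENNReal.ofReal_le_ofReal_iff (mul_nonneg (by positivity)
    (pow_nonneg (integral_nonneg fun x => hH0 x) 3))).1 h6

lemma Continuous.memLp_cell {f : Sp → ℝ} (hf : Continuous f) (p : ℝ≥0∞) :
    MemLp f p (volume.restrict cell) := by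
  have : IsFiniteMeasure (volume.restrict cell) :=
    isFiniteMeasure_restrict.2 isCompact_Icc.measure_lt_top.ne
  obtain ⟨M, hM⟩ := (isCompact_Icc (a := (0 : Sp)) (b := 1)).exists_bound_of_continuousOn
    hf.continuousOn
  exact MemLp.of_bound hf.aestronglyMeasurable M
    ((ae_restrict_iff' measurableSet_Icc).2 (ae_of_all _ hM))

/-- Gagliardo–Nirenberg inequality on the torus. -/
lemma exists_integral_rpow_le : ∃ C : ℝ, 0 ≤ C ∧ ∀ w : Sp → ℝ, ContDiff ℝ 1 w → Periodic3 w →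
    (∀ x, 0 ≤ w x) → ∫ x in cell, w x ^ (10 / 3 : ℝ) ≤
      C * (∫ x in cell, w x ^ 2) ^ (2 / 3 : ℝ) * ∫ x in cell, (w x ^ 2 + gradSqS w x) := by
  obtain ⟨C, hC, h⟩ := exists_integral_pow_six_le
  refine ⟨C ^ (1 / 3 : ℝ), by positivity, fun w hw hp h0 => ?_⟩
  have hI : 0 ≤ ∫ x in cell, (w x ^ 2 + gradSqS w x) :=
    integral_nonneg fun x => add_nonneg (sq_nonneg _) (gradSqS_nonneg w x)
  have hcf : Continuous fun x => w x ^ (4 / 3 : ℝ) :=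
    hw.continuous.rpow_const fun _ => Or.inr (by norm_num)
  have hH := integral_mul_le_Lp_mul_Lq_of_nonneg (μ := volume.restrict cell)
    (p := 3 / 2) (q := 3) (Real.holderConjugate_iff.2 ⟨by norm_num, by norm_num⟩)
    (f := fun x => w x ^ (4 / 3 : ℝ)) (g := fun x => w x ^ 2)
    (ae_of_all _ fun x => Real.rpow_nonneg (h0 x) _) (ae_of_all _ fun x => sq_nonneg _)
    (hcf.memLp_cell _) ((hw.continuous.pow 2).memLp_cell _)
  have e1 : ∀ x, w x ^ (4 / 3 : ℝ) * w x ^ 2 = w x ^ (10 / 3 : ℝ) := fun x => by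
    rw [← Real.rpow_natCast, ← Real.rpow_add_of_nonneg (h0 x) (by norm_num) (by norm_num)]
    norm_num
  have e2 : ∀ x, (w x ^ (4 / 3 : ℝ)) ^ (3 / 2 : ℝ) = w x ^ 2 := fun x => by
    rw [← Real.rpow_mul (h0 x), ← Real.rpow_natCast]
    norm_num
  have e3 : ∀ x, (w x ^ 2) ^ (3 : ℝ) = w x ^ 6 := fun x => by
    rw [Real.rpow_ofNat, ← pow_mul]
  simp only [e1, e2, e3] at hH
  calc _ ≤ _ := hH
    _ ≤ (∫ x in cell, w x ^ 2) ^ (2 / 3 : ℝ) *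
        (C * (∫ x in cell, (w x ^ 2 + gradSqS w x)) ^ 3) ^ (1 / 3 : ℝ) := by
      rw [show (1 : ℝ) / (3 / 2) = 2 / 3 by norm_num]
      gcongr
      exact h w hw hp
    _ = _ := by
      rw [Real.mul_rpow hC (pow_nonneg hI 3), ← Real.rpow_natCast _ 3, ← Real.rpow_mul hI]
      norm_num
      ring

lemma gradSqS_nsq_rpow_le {v : Sp → Fin 3 → ℝ} (hv : ∀ j, ContDiff ℝ 1 fun x => v x j) {p : ℝ}
    (hp : 2 < p) (x : Sp) : gradSqS (fun x => nsq (v x) ^ (p / 4)) x ≤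
      (p / 2) ^ 2 * (nsq (v x) ^ (p / 2 - 1) * gradSqV v x) := by
  unfold gradSqS gradSqV
  rw [Finset.mul_sum, Finset.mul_sum]
  refine Finset.sum_le_sum fun i _ => ?_
  rw [pd_comp i (hasFDerivAt_nsq_rpow (by linarith) (v x))
    fun j => (hv j).differentiable one_ne_zero x]
  set n := nsq (v x) with hn
  have hn0 : 0 ≤ n := nsq_nonneg _
  set q : Fin 3 → ℝ := fun j => pd i (fun y => v y j) x with hq
  have e : (∑ k, (2 * (p / 4) * n ^ (p / 4 - 1) * v x k) •
      ContinuousLinearMap.proj (R := ℝ) (φ := fun _ : Fin 3 => ℝ) k) q =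
      p / 2 * n ^ (p / 4 - 1) * ∑ k, v x k * q k := by
    simp only [_root_.sum_apply, _root_.smul_apply,
      ContinuousLinearMap.proj_apply, smul_eq_mul, Finset.mul_sum]
    refine Finset.sum_congr rfl fun k _ => ?_
    ring
  rw [e]
  have hcs : (∑ k, v x k * q k) ^ 2 ≤ n * ∑ j, q j ^ 2 := Finset.sum_mul_sq_le_sq_mul_sq _ _ _
  have hpow : (n ^ (p / 4 - 1)) ^ 2 * n ≤ n ^ (p / 2 - 1) := by
    rcases hn0.eq_or_lt with h | h
    · rw [← h, mul_zero]
      positivity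
    · rw [← Real.rpow_natCast, ← Real.rpow_mul hn0, ← Real.rpow_add_one h.ne']
      refine le_of_eq (congrArg _ ?_)
      push_cast
      ring
  calc _ = (p / 2) ^ 2 * ((n ^ (p / 4 - 1)) ^ 2 * (∑ k, v x k * q k) ^ 2) := by ring
    _ ≤ (p / 2) ^ 2 * ((n ^ (p / 4 - 1)) ^ 2 * (n * ∑ j, q j ^ 2)) := by gcongr
    _ = (p / 2) ^ 2 * ((n ^ (p / 4 - 1)) ^ 2 * n * ∑ j, q j ^ 2) := by ring
    _ ≤ _ := by gcongr

/-- Gagliardo–Nirenberg inequality for `|v|^{p/2}`. -/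
lemma exists_integral_nsq_rpow_le {p : ℝ} (hp : 2 < p) :
    ∃ C : ℝ, 0 ≤ C ∧ ∀ v : Sp → Fin 3 → ℝ, (∀ j, ContDiff ℝ 1 fun x => v x j) →
      (∀ j, Periodic3 fun x => v x j) →
      ∫ x in cell, nsq (v x) ^ (5 * p / 6) ≤ C * (∫ x in cell, nsq (v x) ^ (p / 2)) ^ (2 / 3 : ℝ) *
        ((∫ x in cell, nsq (v x) ^ (p / 2)) +
          ∫ x in cell, nsq (v x) ^ (p / 2 - 1) * gradSqV v x) := by
  obtain ⟨C, hC, h⟩ := exists_integral_rpow_le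
  refine ⟨C * (p / 2) ^ 2, by positivity, fun v hv hper => ?_⟩
  have hvc : ContDiff ℝ 1 v := contDiff_pi.2 hv
  have hw : ContDiff ℝ 1 fun x => nsq (v x) ^ (p / 4) :=
    (contDiff_nsq_rpow (by linarith : 1 < 2 * (p / 4))).comp hvc
  have hwp : Periodic3 fun x => nsq (v x) ^ (p / 4) := fun x k => by
    simp only [show v (x + fun i => (k i : ℝ)) = v x from funext fun j => hper j x k]
  have hg := h _ hw hwp fun x => Real.rpow_nonneg (nsq_nonneg _) _
  have e1 : ∀ x, (nsq (v x) ^ (p / 4)) ^ (10 / 3 : ℝ) = nsq (v x) ^ (5 * p / 6) := fun x => by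
    rw [← Real.rpow_mul (nsq_nonneg _)]
    ring_nf
  have e2 : ∀ x, (nsq (v x) ^ (p / 4)) ^ 2 = nsq (v x) ^ (p / 2) := fun x => by
    rw [← Real.rpow_natCast, ← Real.rpow_mul (nsq_nonneg _)]
    push_cast
    ring_nf
  simp only [e1, e2] at hg
  have hn : Continuous fun x => nsq (v x) := continuous_nsq.comp hvc.continuous
  have hc1 : Continuous fun x => nsq (v x) ^ (p / 2) :=
    hn.rpow_const fun _ => Or.inr (by linarith)
  have hc2 : Continuous fun x => nsq (v x) ^ (p / 2 - 1) * gradSqV v x :=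
    (hn.rpow_const fun _ => Or.inr (by linarith)).mul
      (continuous_finsetSum _ fun i _ => continuous_finsetSum _ fun j _ =>
        ((hv j).continuous_pd i).pow 2)
  have hF : 0 ≤ ∫ x in cell, nsq (v x) ^ (p / 2) :=
    integral_nonneg fun x => Real.rpow_nonneg (nsq_nonneg _) _
  have hle : ∫ x in cell, (nsq (v x) ^ (p / 2) + gradSqS (fun x => nsq (v x) ^ (p / 4)) x) ≤
      (p / 2) ^ 2 * ((∫ x in cell, nsq (v x) ^ (p / 2)) +
          ∫ x in cell, nsq (v x) ^ (p / 2 - 1) * gradSqV v x) := by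
    rw [← integral_add hc1.integrableOn_cell hc2.integrableOn_cell, ← integral_const_mul]
    refine integral_mono (hc1.add hw.continuous_gradSqS).integrableOn_cell
      ((hc1.add hc2).const_mul _).integrableOn_cell fun x => ?_
    have h1 := gradSqS_nsq_rpow_le hv hp x
    have h2 := Real.rpow_nonneg (nsq_nonneg (v x)) (p / 2)
    simp only [mul_add]
    exact add_le_add (le_mul_of_one_le_left h2 (one_le_pow₀ (by linarith))) h1
  calc _ ≤ _ := hg
    _ ≤ _ := mul_le_mul_of_nonneg_left hle (by positivity)
    _ = _ := by ring

lemma integral_cell_one_add {f : Sp → ℝ} (hf : Continuous f) :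
    ∫ x in cell, (1 + f x) = 1 + ∫ x in cell, f x := by
  rw [integral_add continuous_const.integrableOn_cell hf.integrableOn_cell]
  simp [cell, Measure.real, Real.volume_Icc_pi]

lemma sq_div_le_gradSqV (v : Sp → Fin 3 → ℝ) (x : Sp) :
    (∑ i, pd i (fun y => v y i) x) ^ 2 ≤ 3 * gradSqV v x := by
  have h := sq_sum_le_card_mul_sum_sq (s := Finset.univ) (f := fun i => pd i (fun y => v y i) x)
  refine h.trans ?_
  simp only [Finset.card_univ, Fintype.card_fin, Nat.cast_ofNat]
  refine mul_le_mul_of_nonneg_left (Finset.sum_le_sum fun i _ => ?_) (by norm_num)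
  exact Finset.single_le_sum (f := fun j => pd i (fun y => v y j) x ^ 2)
    (fun _ _ => sq_nonneg _) (Finset.mem_univ i)

lemma gradSqV_nonneg (v : Sp → Fin 3 → ℝ) (x : Sp) : 0 ≤ gradSqV v x :=
  Finset.sum_nonneg fun _ _ => Finset.sum_nonneg fun _ _ => sq_nonneg _

lemma le_one_add_rpow {a q : ℝ} (ha : 0 ≤ a) (hq : 1 ≤ q) : a ≤ 1 + a ^ q := by
  rcases le_total a 1 with h | h
  · linarith [Real.rpow_nonneg ha q]
  · linarith [Real.self_le_rpow_of_one_le h hq]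

lemma young_weighted {ν m θ g y d : ℝ} (hν : 0 < ν) (hθ : 0 < θ) (hm : 1 / 2 ≤ m * θ)
    (hd : d ^ 2 ≤ 3 * g) : y * |d| ≤ ν / 2 * (θ * g) + 3 * m / ν * y ^ 2 := by
  have h1 : y * |d| ≤ ν * θ / 6 * d ^ 2 + 3 / (2 * (ν * θ)) * y ^ 2 := by
    rw [← sq_abs d]
    have hνθ : 0 < ν * θ := by positivity
    have : ν * θ / 6 * |d| ^ 2 + 3 / (2 * (ν * θ)) * y ^ 2 - y * |d| =
        (ν * θ * |d| - 3 * y) ^ 2 / (6 * (ν * θ)) := by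
      field_simp
      ring
    have h0 : 0 ≤ (ν * θ * |d| - 3 * y) ^ 2 / (6 * (ν * θ)) := by positivity
    linarith
  have h2 : 3 / (2 * (ν * θ)) ≤ 3 * m / ν := by
    rw [div_le_div_iff₀ (by positivity) hν]
    nlinarith
  have h3 : ν * θ / 6 * d ^ 2 ≤ ν / 2 * (θ * g) := by
    have : ν * θ / 6 * d ^ 2 ≤ ν * θ / 6 * (3 * g) := by gcongr
    linarith
  have h4 : 3 / (2 * (ν * θ)) * y ^ 2 ≤ 3 * m / ν * y ^ 2 := by gcongr
  linarith

lemma nsq_mul_div_le {ν γ m c θ : ℝ} (hν : 0 < ν) (hγ : 9 / 4 ≤ γ) (hc0 : 0 ≤ c) (hc1 : c ≤ 1)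
    (hθ : 0 < θ) (hm : 1 / 2 ≤ m * θ) (v : Sp → Fin 3 → ℝ) (x : Sp) :
    c * (nsq (v x) * ∑ i, pd i (fun y => v y i) x) ≤
      ν / 2 * (θ * gradSqV v x) + ν / 2 * (θ * (nsq (v x) ^ (γ / 2 - 1) * gradSqV v x))
        + 3 * m / ν * (1 + nsq (v x) ^ (5 * γ / 6)) := by
  have hn := nsq_nonneg (v x)
  have hd := sq_div_le_gradSqV v x
  set n := nsq (v x)
  set d := ∑ i, pd i (fun y => v y i) x
  set g := gradSqV v x
  set z := n ^ ((γ / 2 - 1) / 2) with hz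
  set y := n ^ (5 * γ / 12) with hy
  have hz2 : z ^ 2 = n ^ (γ / 2 - 1) := by
    rw [hz, ← Real.rpow_natCast, ← Real.rpow_mul hn]
    push_cast
    ring_nf
  have hy2 : y ^ 2 = n ^ (5 * γ / 6) := by
    rw [hy, ← Real.rpow_natCast, ← Real.rpow_mul hn]
    push_cast
    ring_nf
  have hn1 : n ≤ 1 + y * z := by
    rw [hy, hz, ← Real.rpow_add_of_nonneg hn (by linarith) (by linarith)]
    exact le_one_add_rpow hn (by linarith)
  have hz0 : 0 ≤ z := Real.rpow_nonneg hn _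
  have y1 := young_weighted (y := 1) hν hθ hm hd
  have y2 := young_weighted (y := y) (d := z * d) (g := z ^ 2 * g) hν hθ hm
    (by rw [mul_pow]; nlinarith [sq_nonneg z])
  rw [abs_mul, abs_of_nonneg hz0] at y2
  have h1 : c * (n * d) ≤ n * |d| := by
    have : n * d ≤ n * |d| := mul_le_mul_of_nonneg_left (le_abs_self d) hn
    have h0 : 0 ≤ n * |d| := by positivity
    nlinarith
  have h2 : n * |d| ≤ (1 + y * z) * |d| := by gcongr
  rw [← hz2, ← hy2]
  nlinarith

lemma le_add_mul_of_deriv_le {f : ℝ → ℝ} {T R : ℝ}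
    (hf : ∀ t ∈ Set.Icc (0 : ℝ) T, ∃ d, HasDerivAt f d t ∧ d ≤ R) :
    ∀ t ∈ Set.Icc (0 : ℝ) T, f t ≤ f 0 + R * t := by
  intro t ht
  have h := (convex_Icc (0 : ℝ) T).image_sub_le_mul_sub_of_deriv_le (f := f) (C := R)
    (fun s hs => let ⟨_, h, _⟩ := hf s hs; h.continuousAt.continuousWithinAt)
    (fun s hs => let ⟨_, h, _⟩ := hf s (interior_subset hs);
      h.differentiableAt.differentiableWithinAt)
    (fun s hs => let ⟨_, h, h'⟩ := hf s (interior_subset hs); h.deriv.trans_le h')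
    0 ⟨le_rfl, ht.1.trans ht.2⟩ t ht ht.1
  linarith

namespace ThermalBurgers

variable {ν κ γ T : ℝ} {u : ℝ → Sp → Fin 3 → ℝ} {θ : ℝ → Sp → ℝ}

lemma θ_pos (h : ThermalBurgers ν κ γ T u θ) (hν : 0 < ν) (hκ : 0 < κ) {t : ℝ}
    (ht : t ∈ Set.Icc (0 : ℝ) T) (x : Sp) : 0 < θ t x := by
  have h1 := h.half_le_mul_θ hν hκ ht x
  have h2 : 0 < 1 + 3 / (8 * ν) * t := by
    have := ht.1
    positivity
  by_contra! h3
  nlinarith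

lemma continuous_nsq_rpow (h : ThermalBurgers ν κ γ T u θ) (t : ℝ) {a : ℝ} (ha : 0 ≤ a) :
    Continuous fun x => nsq (u t x) ^ a :=
  (continuous_nsq.comp (h.contDiff_u' t).continuous).rpow_const fun _ => Or.inr ha

/-- For `γ = 2` the nonlinearity does not contribute to the energy balance. -/
lemma energy_le_of_eq_two (h : ThermalBurgers ν κ 2 T u θ) (hν : 0 < ν) (hκ : 0 < κ) {t : ℝ}
    (ht : t ∈ Set.Icc (0 : ℝ) T) :
    1 / 2 * (∫ x in cell, nsq (u t x)) + (∫ x in cell, θ t x ^ 2) ≤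
      1 / 2 * (∫ x in cell, nsq (u 0 x)) + ∫ x in cell, θ 0 x ^ 2 := by
  have key := le_add_mul_of_deriv_le (T := T) (R := 0)
    (f := fun s => 1 / 2 * (∫ x in cell, nsq (u s x)) + ∫ x in cell, θ s x ^ 2)
    (fun s hs => by
      obtain ⟨d, hd, hle⟩ := h.hasDerivAt_Lp hν le_rfl hs fun x => (h.θ_pos hν hκ hs x).le
      norm_num at hd hle
      exact ⟨_, (hd.const_mul (1 / 2)).add (h.hasDerivAt_heat hs), by linarith⟩) t ht
  simpa using key

lemma Lp_antitone (h : ThermalBurgers ν κ γ T u θ) (hν : 0 < ν) (hκ : 0 < κ) (hγ : 2 ≤ γ) {t : ℝ}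
    (ht : t ∈ Set.Icc (0 : ℝ) T) :
    ∫ x in cell, nsq (u t x) ^ (γ / 2) ≤ ∫ x in cell, nsq (u 0 x) ^ (γ / 2) := by
  have key := le_add_mul_of_deriv_le (T := T) (R := 0)
    (f := fun s => ∫ x in cell, nsq (u s x) ^ (γ / 2))
    (fun s hs => by
      obtain ⟨d, hd, hle⟩ := h.hasDerivAt_Lp hν hγ hs fun x => (h.θ_pos hν hκ hs x).le
      refine ⟨d, hd, hle.trans ?_⟩
      rw [div_self (by linarith), sub_self, zero_mul, zero_sub, neg_nonpos]
      refine mul_nonneg (by positivity) (integral_nonneg fun x => ?_)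
      exact mul_nonneg (h.θ_pos hν hκ hs x).le
        (mul_nonneg (Real.rpow_nonneg (nsq_nonneg _) _) (gradSqV_nonneg _ _))) t ht
  simpa using key

/-- Energy bound in terms of the `L^γ` norm of the initial velocity; `C` is the constant of the
Gagliardo–Nirenberg inequality. -/
lemma energy_le (h : ThermalBurgers ν κ γ T u θ) (hν : 0 < ν) (hκ : 0 < κ) (hγ : 9 / 4 ≤ γ)
    {C m X : ℝ} (hC : 0 ≤ C) (hm : m = 1 + 3 / (8 * ν) * T)
    (hX : X = ∫ x in cell, nsq (u 0 x) ^ (γ / 2))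
    (hGN : ∀ v : Sp → Fin 3 → ℝ, (∀ j, ContDiff ℝ 1 fun x => v x j) →
      (∀ j, Periodic3 fun x => v x j) →
      ∫ x in cell, nsq (v x) ^ (5 * γ / 6) ≤ C * (∫ x in cell, nsq (v x) ^ (γ / 2)) ^ (2 / 3 : ℝ) *
        ((∫ x in cell, nsq (v x) ^ (γ / 2)) +
          ∫ x in cell, nsq (v x) ^ (γ / 2 - 1) * gradSqV v x))
    {t : ℝ} (ht : t ∈ Set.Icc (0 : ℝ) T) :
    (∫ x in cell, nsq (u t x)) + (∫ x in cell, θ t x ^ 2) ≤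
      (∫ x in cell, nsq (u 0 x)) + (∫ x in cell, θ 0 x ^ 2)
        + (ν / 2 + 6 * m ^ 2 / ν * (C * X ^ (2 / 3 : ℝ))) / (ν * γ) * X
        + 3 * m / ν * (1 + C * X ^ (2 / 3 : ℝ) * X) * T := by
  have hT := h.T_pos
  have hγ0 : 0 < γ := by linarith
  have hm0 : 0 < m := by rw [hm]; positivity
  have hX0 : 0 ≤ X := by
    rw [hX]
    exact integral_nonneg fun x => Real.rpow_nonneg (nsq_nonneg _) _
  set lam := (ν / 2 + 6 * m ^ 2 / ν * (C * X ^ (2 / 3 : ℝ))) / (ν * γ) with hlam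
  have hlam0 : 0 ≤ lam := by positivity
  set R := 3 * m / ν * (1 + C * X ^ (2 / 3 : ℝ) * X) with hR
  have hR0 : 0 ≤ R := by positivity
  have hderiv : ∀ s ∈ Set.Icc (0 : ℝ) T, ∃ d, HasDerivAt (fun s => (∫ x in cell, nsq (u s x))
      + (∫ x in cell, θ s x ^ 2) + lam * ∫ x in cell, nsq (u s x) ^ (γ / 2)) d s ∧ d ≤ R := by
    intro s hs
    have hθ0 : ∀ x, 0 < θ s x := h.θ_pos hν hκ hs
    have hmθ : ∀ x, 1 / 2 ≤ m * θ s x := fun x => by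
      refine (h.half_le_mul_θ hν hκ hs x).trans ?_
      rw [hm]
      have := hs.2
      have := (hθ0 x).le
      gcongr
    obtain ⟨d₂, hd₂, hle₂⟩ := h.hasDerivAt_Lp hν le_rfl hs fun x => (hθ0 x).le
    obtain ⟨d, hd, hle⟩ := h.hasDerivAt_Lp hν (by linarith : 2 ≤ γ) hs fun x => (hθ0 x).le
    rw [div_self hγ0.ne', sub_self, zero_mul, zero_sub] at hle
    simp only [div_self (two_ne_zero' ℝ), sub_self, Real.rpow_zero, Real.rpow_one, one_mul]
      at hd₂ hle₂
    refine ⟨_, (hd₂.add (h.hasDerivAt_heat hs)).add (hd.const_mul lam), ?_⟩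
    have hF := h.Lp_antitone hν hκ (by linarith) hs
    rw [← hX] at hF
    have hcn : Continuous fun x => nsq (u s x) :=
      continuous_nsq.comp (h.contDiff_u' s).continuous
    have hcθ := (h.contDiff_θ s).continuous
    have hcg := h.continuous_gradSqV s
    have hc56 := h.continuous_nsq_rpow s (a := 5 * γ / 6) (by linarith)
    have hcw : Continuous fun x => nsq (u s x) ^ (γ / 2 - 1) * gradSqV (u s) x :=
      (h.continuous_nsq_rpow s (by linarith)).mul hcg
    have hcdiv : Continuous fun x => ∑ i, pd i (fun y => u s y i) x :=
      continuous_finsetSum _ fun i _ => (contDiff_pd i (h.contDiff_u s i)).continuous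
    have hgn := hGN (u s) (fun j => (h.contDiff_u s j).of_le (by simp)) (h.periodic_u s)
    set D := ∫ x in cell, θ s x * gradSqV (u s) x with hD
    set G := ∫ x in cell, θ s x * (nsq (u s x) ^ (γ / 2 - 1) * gradSqV (u s) x) with hG
    set S := ∫ x in cell, nsq (u s x) ^ (5 * γ / 6) with hS
    set W := ∫ x in cell, nsq (u s x) ^ (γ / 2 - 1) * gradSqV (u s) x with hW
    set F := ∫ x in cell, nsq (u s x) ^ (γ / 2) with hFdef
    have hF0 : 0 ≤ F := integral_nonneg fun x => Real.rpow_nonneg (nsq_nonneg _) _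
    have hw0 : ∀ x, 0 ≤ nsq (u s x) ^ (γ / 2 - 1) * gradSqV (u s) x := fun x =>
      mul_nonneg (Real.rpow_nonneg (nsq_nonneg _) _) (gradSqV_nonneg _ _)
    have hW0 : 0 ≤ W := integral_nonneg hw0
    have hG0 : 0 ≤ G := integral_nonneg fun x => mul_nonneg (hθ0 x).le (hw0 x)
    have hD0 : 0 ≤ D := integral_nonneg fun x => mul_nonneg (hθ0 x).le (gradSqV_nonneg _ _)
    have hWG : W ≤ 2 * m * G := by
      rw [hW, hG, ← integral_const_mul]
      refine integral_mono hcw.integrableOn_cell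
        ((hcθ.mul hcw).const_mul _).integrableOn_cell fun x => ?_
      have := mul_le_mul_of_nonneg_right (hmθ x) (hw0 x)
      simp only
      linarith
    have hI : (1 - 2 / γ) * (∫ x in cell, nsq (u s x) * ∑ i, pd i (fun y => u s y i) x) ≤
        ν / 2 * D + ν / 2 * G + 3 * m / ν * (1 + S) := by
      have hcD : Continuous fun x => ν / 2 * (θ s x * gradSqV (u s) x) :=
        (hcθ.mul hcg).const_mul (ν / 2)
      have hcG : Continuous fun x =>
          ν / 2 * (θ s x * (nsq (u s x) ^ (γ / 2 - 1) * gradSqV (u s) x)) :=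
        (hcθ.mul hcw).const_mul (ν / 2)
      have hcS := (hc56.const_add 1).const_mul (3 * m / ν)
      rw [hD, hG, hS, ← integral_cell_one_add hc56, ← integral_const_mul, ← integral_const_mul,
        ← integral_const_mul, ← integral_const_mul,
        ← integral_add hcD.integrableOn_cell hcG.integrableOn_cell,
        ← integral_add (hcD.fun_add hcG).integrableOn_cell hcS.integrableOn_cell]
      refine integral_mono ((hcn.mul hcdiv).const_mul _).integrableOn_cell
        ((hcD.add hcG).add hcS).integrableOn_cell fun x => ?_
      refine nsq_mul_div_le hν hγ ?_ ?_ (hθ0 x) (hmθ x) (u s) x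
      · rw [sub_nonneg, div_le_one hγ0]
        linarith
      · have : 0 ≤ 2 / γ := by positivity
        linarith
    have hSle : S ≤ C * X ^ (2 / 3 : ℝ) * (X + 2 * m * G) :=
      hgn.trans (by gcongr)
    have hS' : 3 * m / ν * (1 + S) ≤ 3 * m / ν * (1 + C * X ^ (2 / 3 : ℝ) * (X + 2 * m * G)) := by
      gcongr
    have hld : lam * d ≤ -((ν / 2 + 6 * m ^ 2 / ν * (C * X ^ (2 / 3 : ℝ))) * G) := by
      calc lam * d ≤ lam * (-(ν * γ * G)) := by gcongr
        _ = _ := by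
          rw [hlam]
          field_simp
    have e : 3 * m / ν * (1 + C * X ^ (2 / 3 : ℝ) * (X + 2 * m * G)) =
        R + 6 * m ^ 2 / ν * (C * X ^ (2 / 3 : ℝ)) * G := by
      rw [hR]
      ring
    have hνD : 0 ≤ ν * D := by positivity
    linarith
  have key := le_add_mul_of_deriv_le hderiv t ht
  simp only [← hX] at key
  have h1 : 0 ≤ lam * ∫ x in cell, nsq (u t x) ^ (γ / 2) :=
    mul_nonneg hlam0 (integral_nonneg fun x => Real.rpow_nonneg (nsq_nonneg _) _)
  have h2 : R * t ≤ R * T := mul_le_mul_of_nonneg_left ht.2 hR0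
  linarith

end ThermalBurgers

lemma rpow_le_rpow_add_one {X p q : ℝ} (hX : 0 ≤ X) (hp : 0 ≤ p) (hpq : p ≤ q) :
    X ^ p ≤ X ^ q + 1 := by
  rcases le_total X 1 with h | h
  · linarith [Real.rpow_le_one hX h hp, Real.rpow_nonneg hX q]
  · linarith [Real.rpow_le_rpow_of_exponent_le h hpq]

/-- **Proposition 3.1 (energy bound), thermal reduced Burgers.** For `γ = 2` or `γ ≥ 9/4`
there is `C = C(ν,γ) > 0` with `sup_{t∈[0,T]} (½‖u(t)‖²_{L²} + ‖θ(t)‖²_{L²}) ≤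
½‖u₀‖²_{L²} + ‖θ₀‖²_{L²} + C(T²+1)(‖u₀‖^{3γ−3}_{L^γ} + 1)`. -/
theorem thermalBurgers_energy_bound (ν γ : ℝ) (hν : 0 < ν)
    (hγ : γ = 2 ∨ (9 : ℝ) / 4 ≤ γ) :
    ∃ C : ℝ, 0 < C ∧
      ∀ (κ T : ℝ) (u : ℝ → Sp → Fin 3 → ℝ) (θ : ℝ → Sp → ℝ),
        0 < κ → ThermalBurgers ν κ γ T u θ →
        ∀ t ∈ Set.Icc (0 : ℝ) T,
          (1 / 2) * (∫ x in cell, ∑ j, u t x j ^ 2) + (∫ x in cell, θ t x ^ 2)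
            ≤ (1 / 2) * (∫ x in cell, ∑ j, u 0 x j ^ 2) + (∫ x in cell, θ 0 x ^ 2)
              + C * (T ^ 2 + 1)
                * (((∫ x in cell, (∑ j, u 0 x j ^ 2) ^ (γ / 2)) ^ (1 / γ))
                    ^ (3 * γ - 3) + 1) := by
  rcases hγ with rfl | hγ
  · refine ⟨1, one_pos, fun κ T u θ hκ h t ht => ?_⟩
    have h0 : 0 ≤ ∫ x in cell, (∑ j, u 0 x j ^ 2) ^ ((2 : ℝ) / 2) :=
      integral_nonneg fun x => Real.rpow_nonneg (nsq_nonneg (u 0 x)) _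
    exact (h.energy_le_of_eq_two hν hκ ht).trans (le_add_of_nonneg_right (by positivity))
  have hγ0 : 0 < γ := by linarith
  obtain ⟨C, hC, hGN⟩ := exists_integral_nsq_rpow_le (by linarith : 2 < γ)
  let k := 3 / (8 * ν)
  have hk : 0 < k := by positivity
  refine ⟨1 + 1 / (2 * γ) + 12 * C * (1 + k ^ 2) / (ν ^ 2 * γ) + 3 / ν * (1 + k) * (1 + C),
    by positivity, fun κ T u θ hκ h t ht => ?_⟩
  have hT := h.T_pos
  have key := h.energy_le hν hκ hγ hC rfl rfl hGN ht
  change 1 / 2 * (∫ x in cell, nsq (u t x)) + _ ≤ 1 / 2 * (∫ x in cell, nsq (u 0 x)) + _ +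
    _ * ((((∫ x in cell, nsq (u 0 x) ^ (γ / 2)) ^ (1 / γ)) ^ (3 * γ - 3)) + 1)
  set X := ∫ x in cell, nsq (u 0 x) ^ (γ / 2) with hX
  have hX0 : 0 ≤ X := integral_nonneg fun x => Real.rpow_nonneg (nsq_nonneg _) _
  have hq : 5 / 3 ≤ 1 / γ * (3 * γ - 3) := by
    rw [div_mul_eq_mul_div, le_div_iff₀ hγ0]
    linarith
  rw [← Real.rpow_mul hX0]
  set Y := X ^ (1 / γ * (3 * γ - 3)) + 1 with hY
  have hY1 : 1 ≤ Y := by linarith [Real.rpow_nonneg hX0 (1 / γ * (3 * γ - 3))]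
  have hXY : X ≤ Y := by
    have := rpow_le_rpow_add_one hX0 zero_le_one (by linarith : 1 ≤ 1 / γ * (3 * γ - 3))
    rwa [Real.rpow_one] at this
  have h53 : X ^ (2 / 3 : ℝ) * X = X ^ (5 / 3 : ℝ) := by
    rw [← Real.rpow_add_one' hX0 (by norm_num)]
    norm_num
  have hXY' : X ^ (2 / 3 : ℝ) * X ≤ Y := by
    rw [h53]
    exact rpow_le_rpow_add_one hX0 (by norm_num) hq
  have hA0 : ∫ x in cell, nsq (u 0 x) ≤ 1 + X := by
    have hc := h.continuous_nsq_rpow 0 (a := γ / 2) (by linarith)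
    rw [hX, ← integral_cell_one_add hc]
    exact integral_mono (continuous_nsq.comp (h.contDiff_u' 0).continuous).integrableOn_cell
      (hc.const_add 1).integrableOn_cell fun x => le_one_add_rpow (nsq_nonneg _) (by linarith)
  have hAt : 0 ≤ ∫ x in cell, nsq (u t x) := integral_nonneg fun x => nsq_nonneg _
  have hm2 : (1 + k * T) ^ 2 ≤ 2 * (1 + k ^ 2) * (T ^ 2 + 1) := by
    nlinarith [sq_nonneg (1 - k * T), sq_nonneg k, sq_nonneg T]
  have hmT : (1 + k * T) * T ≤ (1 + k) * (T ^ 2 + 1) := by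
    nlinarith [sq_nonneg (T - 1)]
  have hT1 : 1 ≤ T ^ 2 + 1 := by nlinarith
  have t1 : 1 / 2 * (1 + X) ≤ 1 * (T ^ 2 + 1) * Y := by
    nlinarith
  have t2 : (ν / 2 + 6 * (1 + k * T) ^ 2 / ν * (C * X ^ (2 / 3 : ℝ))) / (ν * γ) * X ≤
      (1 / (2 * γ) + 12 * C * (1 + k ^ 2) / (ν ^ 2 * γ)) * (T ^ 2 + 1) * Y := by
    calc _ = 1 / (2 * γ) * X + 6 * C / (ν ^ 2 * γ) * ((1 + k * T) ^ 2 * (X ^ (2 / 3 : ℝ) * X)) := by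
          field_simp
      _ ≤ 1 / (2 * γ) * ((T ^ 2 + 1) * Y) +
          6 * C / (ν ^ 2 * γ) * (2 * (1 + k ^ 2) * (T ^ 2 + 1) * Y) := by
          gcongr
          nlinarith
      _ = _ := by ring
  have t3 : 3 * (1 + k * T) / ν * (1 + C * X ^ (2 / 3 : ℝ) * X) * T ≤
      3 / ν * (1 + k) * (1 + C) * (T ^ 2 + 1) * Y := by
    calc _ = 3 / ν * (((1 + k * T) * T) * (1 + C * (X ^ (2 / 3 : ℝ) * X))) := by ring
      _ ≤ 3 / ν * ((1 + k) * (T ^ 2 + 1) * (Y + C * Y)) := by gcongr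
      _ = _ := by ring
  simp only [k] at t2 t3 ⊢
  linarith
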